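/- Let q be a prime power, d ≥ 2, 2d ≤ m, and let C ≤ F_{q^m}^{2d} be an F_{q^m}-linear code of dimension d whose minimum rank distance is d and whose dual C^⊥ (with respect to the standard inner product on F_{q^m}^{2d}) also has minimum rank distance d (i.e., C is a [2d,d,d] dually almost-MRD code). Assume moreover that C has no codeword of rank weight d+1 (A_{d+1}(C) = 0). Then the set D_d(C) = {supp(c) : c ∈ C, wt(c) = d} is the set of blocks of a q-Steiner system S_q(d−1, d, 2d): every (d−1)-dimensional F_q-subspace of F_q^{2d} is contained in exactly one element of D_d(C). -/

import Mathlib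

open Polynomial

/-- The `q`-ary Gaussian binomial coefficient `[a choose b]_q`. -/
def gaussBinom (q a b : ℕ) : ℕ :=
  if b ≤ a then
    (∏ i ∈ Finset.range b, (q ^ (a - i) - 1)) / (∏ i ∈ Finset.range b, (q ^ (i + 1) - 1))
  else 0

section Dual

variable (K : Type) [Field K] {n : ℕ}

/-- The linear functional `v ↦ ∑ i, u i * v i` given by the standard inner product. -/
def dotL (u : Fin n → K) : (Fin n → K) →ₗ[K] K where
  toFun v := ∑ i, u i * v i
  map_add' a b := by simp [mul_add, Finset.sum_add_distrib]
  map_smul' c a := by simp [Finset.mul_sum, mul_left_comm]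

/-- The dual code with respect to the standard inner product. -/
def dualCode (C : Submodule K (Fin n → K)) : Submodule K (Fin n → K) :=
  ⨅ u ∈ C, LinearMap.ker (dotL K u)

end Dual

section RankMetric

variable (Fq K : Type) [Field Fq] [Field K] [Algebra Fq K] {n : ℕ}

/-- The rank weight of a vector `v ∈ K^n`, `K = F_{q^m}`, over `Fq`. -/
noncomputable def rankWt (v : Fin n → K) : ℕ :=
  Module.finrank Fq (Submodule.span Fq (Set.range v))

/-- The support of `v ∈ K^n`: the `Fq`-subspace of `Fq^n` of all coordinatewise
images of `v` under `Fq`-linear functionals of `K`. -/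
def rsupp (v : Fin n → K) : Submodule Fq (Fin n → Fq) :=
  Submodule.span Fq {w : Fin n → Fq | ∃ f : K →ₗ[Fq] Fq, w = fun i => f (v i)}

/-- The support of an `K`-linear code `C ≤ K^n`. -/
def codeSupp (C : Submodule K (Fin n → K)) : Submodule Fq (Fin n → Fq) :=
  ⨆ v ∈ C, rsupp Fq K v

/-- `C` has minimum rank distance `d`. -/
def IsMinRankDist (C : Submodule K (Fin n → K)) (d : ℕ) : Prop :=
  (∃ c ∈ C, c ≠ 0 ∧ rankWt Fq K c = d) ∧ ∀ c ∈ C, c ≠ 0 → d ≤ rankWt Fq K c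

/-- The `r`-th generalized rank weight of `C`. -/
noncomputable def genRankWt (C : Submodule K (Fin n → K)) (r : ℕ) : ℕ :=
  sInf {w | ∃ D : Submodule K (Fin n → K), D ≤ C ∧ Module.finrank K D = r ∧
    Module.finrank Fq (codeSupp Fq K D) = w}

end RankMetric

/-- A `q`-Steiner system `S_q(t,k,n)` with block set `B`: every block is a
`k`-dimensional `Fq`-subspace of `Fq^n`, and every `t`-dimensional subspace is
contained in exactly one block. -/
def IsSteinerSystemQ (Fq : Type) [Field Fq] (t k n : ℕ)
    (B : Set (Submodule Fq (Fin n → Fq))) : Prop :=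
  (∀ b ∈ B, Module.finrank Fq b = k) ∧
  ∀ W : Submodule Fq (Fin n → Fq), Module.finrank Fq W = t → ∃! b, b ∈ B ∧ W ≤ b

section Subspaces

variable {F V V' : Type*} [Field F] [AddCommGroup V] [Module F V] [FiniteDimensional F V]
  [AddCommGroup V'] [Module F V'] [FiniteDimensional F V']

/-- In spaces of equal dimension `k + j`, the subspaces of dimension `k` of one are equinumerous
with the subspaces of dimension `j` of the other. -/
theorem nonempty_equiv_subspaces_of_add_eq {n k j : ℕ} (hV : Module.finrank F V = n)
    (hV' : Module.finrank F V' = n) (hkj : k + j = n) :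
    Nonempty ({W : Submodule F V // Module.finrank F W = k} ≃
      {W : Submodule F V' // Module.finrank F W = j}) := by
  let e : Module.Dual F V ≃ₗ[F] V' :=
    LinearEquiv.ofFinrankEq _ _ (by rw [Subspace.dual_finrank_eq, hV, hV'])
  let Φ : Submodule F V ≃ Submodule F V' :=
    ((Subspace.orderIsoFiniteDimensional (K := F) (V := V)).toEquiv.trans
      OrderDual.ofDual).trans (Submodule.orderIsoMapComap e).toEquiv
  refine ⟨Φ.subtypeEquiv fun W => ?_⟩
  have h₁ : Φ W = W.dualAnnihilator.map (e : Module.Dual F V →ₗ[F] V') := rfl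
  have h₂ := Subspace.finrank_add_finrank_dualAnnihilator_eq W
  rw [h₁, LinearEquiv.finrank_map_eq]
  omega

/-- The subspaces of codimension `1` in `S` are equinumerous with the subspaces in which `S` has
codimension `1`, when `S` has half the dimension of the space. -/
theorem nonempty_equiv_hyperplanes_overspaces {d : ℕ} (hd : 1 ≤ d)
    (hV : Module.finrank F V = 2 * d) (S : Submodule F V) (hS : Module.finrank F S = d) :
    Nonempty ({W : Submodule F V // Module.finrank F W = d - 1 ∧ W ≤ S} ≃
      {U : Submodule F V // Module.finrank F U = d + 1 ∧ S ≤ U}) := by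
  have hQ : Module.finrank F (V ⧸ S) = d := by
    have := S.finrank_quotient_add_finrank
    omega
  obtain ⟨e⟩ := nonempty_equiv_subspaces_of_add_eq (k := d - 1) (j := 1) hS hQ (by omega)
  have e₁ : {W : Submodule F S // Module.finrank F W = d - 1} ≃
      {W : Submodule F V // Module.finrank F W = d - 1 ∧ W ≤ S} :=
    ((S.mapIic.toEquiv.subtypeEquiv (q := fun W : Set.Iic S => Module.finrank F W.1 = d - 1)
      fun W => by
        change _ ↔ Module.finrank F (W.map S.subtype) = _
        rw [Submodule.finrank_map_subtype_eq]).trans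
      (Equiv.subtypeSubtypeEquivSubtypeInter (· ≤ S)
        fun W : Submodule F V => Module.finrank F W = d - 1)).trans
      (Equiv.subtypeEquivRight fun _ => and_comm)
  have e₂ : {W : Submodule F (V ⧸ S) // Module.finrank F W = 1} ≃
      {U : Submodule F V // Module.finrank F U = d + 1 ∧ S ≤ U} :=
    (((Submodule.comapMkQRelIso S).toEquiv.subtypeEquiv
      (q := fun U : Set.Ici S => Module.finrank F U.1 = d + 1)
      fun W => by
        change _ ↔ Module.finrank F (W.comap S.mkQ) = _
        have h := LinearMap.finrank_range_add_finrank_ker (S.mkQ.domRestrict (W.comap S.mkQ))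
        rw [LinearMap.range_domRestrict, Submodule.map_comap_eq_of_surjective S.mkQ_surjective,
          LinearMap.ker_domRestrict, Submodule.ker_mkQ,
          (Submodule.comapSubtypeEquivOfLe (S.le_comap_mkQ W)).finrank_eq, hS] at h
        omega).trans
      (Equiv.subtypeSubtypeEquivSubtypeInter (S ≤ ·)
        fun U : Submodule F V => Module.finrank F U = d + 1)).trans
      (Equiv.subtypeEquivRight fun _ => and_comm)
  exact ⟨(e₁.symm.trans e).trans e₂⟩

/-- If every `(d+1)`-dimensional subspace of a `2d`-dimensional space contains exactly one block
of a family of `d`-dimensional subspaces, then every `(d-1)`-dimensional subspace is contained in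
exactly one block. -/
theorem existsUnique_block_ge_of_existsUnique_block_le [Finite V] {d : ℕ} (hd : 1 ≤ d)
    (hV : Module.finrank F V = 2 * d) (B : Set (Submodule F V))
    (hB : ∀ S ∈ B, Module.finrank F S = d)
    (hU : ∀ U : Submodule F V, Module.finrank F U = d + 1 → ∃! S, S ∈ B ∧ S ≤ U)
    (W : Submodule F V) (hW : Module.finrank F W = d - 1) : ∃! S, S ∈ B ∧ W ≤ S := by
  have huniq : ∀ W : Submodule F V, Module.finrank F W = d - 1 → ∀ S ∈ B, ∀ S' ∈ B,
      W ≤ S → W ≤ S' → S = S' := by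
    intro W hW S hS S' hS' h h'
    by_contra hne
    have hlt : S ⊓ S' < S := by
      refine lt_of_le_of_ne inf_le_left fun heq => hne ?_
      exact Submodule.eq_of_le_of_finrank_eq (inf_eq_left.mp heq) (by rw [hB S hS, hB S' hS'])
    have h₁ := Submodule.finrank_lt_finrank_of_lt hlt
    have h₂ := Submodule.finrank_mono (le_inf h h')
    have h₃ := Submodule.finrank_sup_add_finrank_inf_eq S S'
    rw [hB S hS] at h₁ h₃
    rw [hB S' hS'] at h₃
    exact hne ((hU (S ⊔ S') (by omega)).unique ⟨hS, le_sup_left⟩ ⟨hS', le_sup_right⟩)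
  let X₁ := Σ S : B, {U : Submodule F V // Module.finrank F U = d + 1 ∧ S.1 ≤ U}
  let X₂ := Σ S : B, {W : Submodule F V // Module.finrank F W = d - 1 ∧ W ≤ S.1}
  have e₁₂ : X₂ ≃ X₁ := Equiv.sigmaCongrRight fun S =>
    (nonempty_equiv_hyperplanes_overspaces hd hV S.1 (hB S.1 S.2)).some
  have e₁ : X₁ ≃ {U : Submodule F V // Module.finrank F U = d + 1} := by
    refine Equiv.ofBijective (fun x => ⟨x.2.1, x.2.2.1⟩) ⟨?_, ?_⟩
    · rintro ⟨⟨S, hS⟩, U, hU₁, hSU⟩ ⟨⟨S', hS'⟩, U', hU₁', hSU'⟩ h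
      obtain rfl : U = U' := congrArg Subtype.val h
      obtain rfl : S = S' := (hU U hU₁).unique ⟨hS, hSU⟩ ⟨hS', hSU'⟩
      rfl
    · rintro ⟨U, hU₁⟩
      obtain ⟨S, ⟨hS, hSU⟩, -⟩ := hU U hU₁
      exact ⟨⟨⟨S, hS⟩, U, hU₁, hSU⟩, rfl⟩
  obtain ⟨e₂⟩ := nonempty_equiv_subspaces_of_add_eq (k := d + 1) (j := d - 1) hV hV (by omega)
  let f : X₂ → {W : Submodule F V // Module.finrank F W = d - 1} := fun x => ⟨x.2.1, x.2.2.1⟩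
  have hf : Function.Injective f := by
    rintro ⟨⟨S, hS⟩, W, hW₁, hWS⟩ ⟨⟨S', hS'⟩, W', hW₁', hWS'⟩ h
    obtain rfl : W = W' := congrArg Subtype.val h
    obtain rfl : S = S' := huniq W hW₁ S hS S' hS' hWS hWS'
    rfl
  have hsurj : Function.Surjective f :=
    (Finite.injective_iff_surjective_of_equiv ((e₁₂.trans e₁).trans e₂)).mp hf
  obtain ⟨⟨⟨S, hS⟩, W', _, hWS⟩, h⟩ := hsurj ⟨W, hW⟩
  obtain rfl : W' = W := congrArg Subtype.val h
  exact ⟨S, ⟨hS, hWS⟩, fun S' hS' => huniq W' hW S' hS'.1 S hS hS'.2 hWS⟩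

end Subspaces

section Support

variable {Fq K : Type} [Field Fq] [Field K] [Algebra Fq K] {n : ℕ}

theorem rsupp_le_iff (v : Fin n → K) (U : Submodule Fq (Fin n → Fq)) :
    rsupp Fq K v ≤ U ↔ ∀ f : K →ₗ[Fq] Fq, (fun i => f (v i)) ∈ U := by
  rw [rsupp, Submodule.span_le]
  exact ⟨fun h f => h ⟨f, rfl⟩, by rintro h _ ⟨f, rfl⟩; exact h f⟩

theorem rsupp_smul_le (a : K) (v : Fin n → K) : rsupp Fq K (a • v) ≤ rsupp Fq K v :=
  (rsupp_le_iff _ _).2 fun f =>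
    (rsupp_le_iff v _).1 le_rfl (f ∘ₗ LinearMap.mulLeft Fq a)

theorem finrank_rsupp [FiniteDimensional Fq K] (v : Fin n → K) :
    Module.finrank Fq (rsupp Fq K v) = rankWt Fq K v := by
  let T : (Fin n → Fq) →ₗ[Fq] K := Module.piEquiv (Fin n) Fq K v
  have h : (rsupp Fq K v).map (Module.piEquiv (Fin n) Fq Fq).toLinearMap =
      LinearMap.range T.dualMap := by
    have hT : ∀ f : K →ₗ[Fq] Fq,
        Module.piEquiv (Fin n) Fq Fq (fun i => f (v i)) = T.dualMap f := fun f => by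
      ext u
      simp [T, Module.piEquiv_apply_apply, Pi.single_apply]
    apply le_antisymm
    · rw [Submodule.map_le_iff_le_comap, rsupp_le_iff]
      exact fun f => ⟨f, (hT f).symm⟩
    · rintro _ ⟨f, rfl⟩
      exact ⟨fun i => f (v i), (rsupp_le_iff v _).1 le_rfl f, hT f⟩
  rw [← LinearEquiv.finrank_map_eq (Module.piEquiv (Fin n) Fq Fq), h,
    LinearMap.finrank_range_dualMap_eq_finrank_range, Module.range_piEquiv, rankWt]

theorem mem_dualCode_iff (C : Submodule K (Fin n → K)) (v : Fin n → K) :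
    v ∈ dualCode K C ↔ ∀ u ∈ C, u ⬝ᵥ v = 0 := by
  simp [dualCode, Submodule.mem_iInf, dotL, dotProduct]

/-- A subspace is the kernel of a parity-check matrix with a right inverse. -/
theorem exists_matrix_mulVec_eq_zero_iff {F : Type*} [Field F] {r : ℕ}
    (U : Submodule F (Fin n → F)) (hU : Module.finrank F U + r = n) :
    ∃ (A : Matrix (Fin r) (Fin n) F) (B : Matrix (Fin n) (Fin r) F),
      A * B = 1 ∧ ∀ u, A.mulVec u = 0 ↔ u ∈ U := by
  have hQ : Module.finrank F ((Fin n → F) ⧸ U) = Module.finrank F (Fin r → F) := by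
    have := U.finrank_quotient_add_finrank
    rw [Module.finrank_fin_fun] at this ⊢
    omega
  let e := LinearEquiv.ofFinrankEq _ _ hQ
  let L : (Fin n → F) →ₗ[F] (Fin r → F) := e.toLinearMap ∘ₗ U.mkQ
  have hL : LinearMap.range L = ⊤ :=
    LinearMap.range_eq_top.2 (e.surjective.comp U.mkQ_surjective)
  obtain ⟨R, hR⟩ := L.exists_rightInverse_of_surjective hL
  refine ⟨LinearMap.toMatrix' L, LinearMap.toMatrix' R, ?_, fun u => ?_⟩
  · rw [← LinearMap.toMatrix'_comp, hR, LinearMap.toMatrix'_id]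
  · rw [LinearMap.toMatrix'_mulVec]
    simp [L]

theorem rankWt_vecMul_map_le {r : ℕ} (A : Matrix (Fin r) (Fin n) Fq) (w : Fin r → K) :
    rankWt Fq K (Matrix.vecMul w (A.map (algebraMap Fq K))) ≤ r := by
  have h : Submodule.span Fq (Set.range (Matrix.vecMul w (A.map (algebraMap Fq K)))) ≤
      Submodule.span Fq (Set.range w) := by
    rw [Submodule.span_le]
    rintro _ ⟨i, rfl⟩
    change ∑ j, w j * A.map (algebraMap Fq K) j i ∈ _
    refine Submodule.sum_mem _ fun j _ => ?_
    rw [Matrix.map_apply, mul_comm, ← Algebra.smul_def]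
    exact Submodule.smul_mem _ _ (Submodule.subset_span ⟨j, rfl⟩)
  have : FiniteDimensional Fq (Submodule.span Fq (Set.range w)) :=
    FiniteDimensional.span_of_finite Fq (Set.finite_range w)
  refine (Submodule.finrank_mono h).trans ((finrank_range_le_card w).trans ?_)
  simp

theorem rsupp_le_iff_mulVec_map_eq_zero {r : ℕ} (A : Matrix (Fin r) (Fin n) Fq)
    (U : Submodule Fq (Fin n → Fq)) (hA : ∀ u, A.mulVec u = 0 ↔ u ∈ U) (v : Fin n → K) :
    rsupp Fq K v ≤ U ↔ (A.map (algebraMap Fq K)).mulVec v = 0 := by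
  have h : ∀ (f : K →ₗ[Fq] Fq) (j : Fin r),
      A.mulVec (fun i => f (v i)) j = f ((A.map (algebraMap Fq K)).mulVec v j) := fun f j => by
    simp [Matrix.mulVec, dotProduct, ← Algebra.smul_def]
  rw [rsupp_le_iff]
  constructor
  · intro hv
    funext j
    refine (Module.forall_dual_apply_eq_zero_iff Fq _).1 fun f => ?_
    rw [← h, (hA _).2 (hv f), Pi.zero_apply]
  · intro hv f
    rw [← hA]
    funext j
    rw [h, hv, Pi.zero_apply, map_zero, Pi.zero_apply]

/-- If the dual code has minimum distance larger than `r`, then every subspace of codimension `r`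
contains the supports of a subcode of codimension exactly `r`. -/
theorem finrank_shortened_code {r k : ℕ} (C : Submodule K (Fin n → K))
    (hC : Module.finrank K C = r + k) (hdual : ∀ c ∈ dualCode K C, c ≠ 0 → r < rankWt Fq K c)
    (U : Submodule Fq (Fin n → Fq)) (hU : Module.finrank Fq U + r = n) :
    ∃ D : Submodule K C, Module.finrank K D = k ∧
      ∀ c : C, c ∈ D ↔ rsupp Fq K c.1 ≤ U := by
  obtain ⟨A, B, hAB, hA⟩ := exists_matrix_mulVec_eq_zero_iff U hU
  let A' := A.map (algebraMap Fq K)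
  let T : C →ₗ[K] (Fin r → K) := A'.mulVecLin.domRestrict C
  refine ⟨LinearMap.ker T, ?_, fun c => (rsupp_le_iff_mulVec_map_eq_zero A U hA c.1).symm⟩
  have hsurj : Function.Surjective T := by
    by_contra hns
    have hlt : LinearMap.range T < ⊤ := lt_top_iff_ne_top.2 (mt LinearMap.range_eq_top.1 hns)
    obtain ⟨φ, hφ, hker⟩ := Submodule.exists_le_ker_of_lt_top _ hlt
    let w : Fin r → K := (Module.piEquiv (Fin r) K K).symm φ
    have hw : ∀ x, φ x = w ⬝ᵥ x := fun x => by
      conv_lhs => rw [← (Module.piEquiv (Fin r) K K).apply_symm_apply φ]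
      rw [Module.piEquiv_apply_apply, dotProduct_comm]
      rfl
    have hmem : Matrix.vecMul w A' ∈ dualCode K C := by
      rw [mem_dualCode_iff]
      intro u hu
      rw [dotProduct_comm, ← Matrix.dotProduct_mulVec, ← hw]
      exact hker ⟨⟨u, hu⟩, rfl⟩
    have hzero : Matrix.vecMul w A' = 0 := by
      by_contra hne
      exact (hdual _ hmem hne).not_ge (rankWt_vecMul_map_le A w)
    have hAB' : A' * B.map (algebraMap Fq K) = 1 := by
      rw [← Matrix.map_mul, hAB, Matrix.map_one _ (map_zero _) (map_one _)]
    have hw0 : w = 0 := by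
      rw [← Matrix.vecMul_one w, ← hAB', ← Matrix.vecMul_vecMul, hzero, Matrix.zero_vecMul]
    exact hφ (LinearMap.ext fun x => by simp [hw, hw0])
  have h := LinearMap.finrank_range_add_finrank_ker T
  rw [LinearMap.range_eq_top.2 hsurj, finrank_top, Module.finrank_fin_fun, hC] at h
  omega

end Support

/-- The supports of the minimum weight codewords of a `[2d,d,d]`
dually AMRD code with no codewords of rank weight `d+1` form the blocks of a
`q`-Steiner system `S_q(d−1, d, 2d)`. -/
theorem steiner_system_of_dually_AMRD
    (Fq K : Type) [Field Fq] [Fintype Fq] [Field K] [Fintype K] [Algebra Fq K]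
    (m d : ℕ) (hd2 : 2 ≤ d) (hm : Module.finrank Fq K = m) (hdm : 2 * d ≤ m)
    (C : Submodule K (Fin (2 * d) → K)) (hdim : Module.finrank K C = d)
    (hmin : IsMinRankDist Fq K C d)
    (hmin' : IsMinRankDist Fq K (dualCode K C) d)
    (hA : ∀ c ∈ C, rankWt Fq K c ≠ d + 1) :
    IsSteinerSystemQ Fq (d - 1) d (2 * d)
      {S : Submodule Fq (Fin (2 * d) → Fq) | ∃ c ∈ C, rankWt Fq K c = d ∧ rsupp Fq K c = S} := by
  have : FiniteDimensional Fq K := Module.Finite.of_finite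
  have hblock : ∀ S ∈ {S : Submodule Fq (Fin (2 * d) → Fq) |
      ∃ c ∈ C, rankWt Fq K c = d ∧ rsupp Fq K c = S}, Module.finrank Fq S = d := by
    rintro _ ⟨c, -, hc, rfl⟩
    rw [finrank_rsupp, hc]
  refine ⟨hblock, fun W hW => existsUnique_block_ge_of_existsUnique_block_le (by omega)
    (Module.finrank_fin_fun Fq) _ hblock (fun U hU => ?_) W hW⟩
  obtain ⟨D, hD, hDU⟩ := finrank_shortened_code (r := d - 1) (k := 1) C (by omega)
    (fun c hc hc0 => by have := hmin'.2 c hc hc0; omega) U (by omega)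
  have hgen : ∃ c : D, c ≠ 0 ∧ ∀ w : D, ∃ a : K, a • c = w := by
    have := Module.Free.of_divisionRing K D
    exact (@finrank_eq_one_iff' K D _ _ _ _ _).1 hD
  obtain ⟨c, hc0, hc⟩ := hgen
  have hcU : rsupp Fq K c.1.1 ≤ U := (hDU c.1).1 c.2
  have hc0' : c.1.1 ≠ 0 := fun h => hc0 (Subtype.ext (Subtype.ext h))
  have hwt : rankWt Fq K c.1.1 = d := by
    have h₁ := hmin.2 _ c.1.2 hc0'
    have h₂ := hA _ c.1.2
    have h₃ := Submodule.finrank_mono hcU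
    rw [finrank_rsupp] at h₃
    omega
  refine ⟨rsupp Fq K c.1.1, ⟨⟨c.1.1, c.1.2, hwt, rfl⟩, hcU⟩, ?_⟩
  rintro _ ⟨⟨c', hc', hwt', rfl⟩, hcU'⟩
  obtain ⟨a, ha⟩ := hc ⟨⟨c', hc'⟩, (hDU ⟨c', hc'⟩).2 hcU'⟩
  have ha' : a • c.1.1 = c' := congrArg (fun x => x.1.1) ha
  exact Submodule.eq_of_le_of_finrank_eq (ha' ▸ rsupp_smul_le a c.1.1)
    (by rw [finrank_rsupp, finrank_rsupp, hwt, hwt'])
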